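/- Let m_1 = 2·m_2 with m_2 odd, let a ∈ F_{2^{m_1}}^*, let γ ∈ F_4^* ⊆ F_{2^{m_1}}^*, and set α = χ_{m_1}(a). Then 3 · ∑_{x ∈ F_{2^{m_1}}^*, χ_{m_1}(x) = γ} (−1)^{Tr^{m_1}(a·x)} = 2^{m_2+1} − 1 if γ = α^{−1}, and 3 · ∑_{x ∈ F_{2^{m_1}}^*, χ_{m_1}(x) = γ} (−1)^{Tr^{m_1}(a·x)} = −2^{m_2} − 1 if γ ≠ α^{−1}. -/

import Mathlib

open Finset

attribute [local instance] Classical.propDecidable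

noncomputable section

/-- The absolute trace `Tr^k` of `GF(2^k)`, as a function on an ambient field of
characteristic two containing `GF(2^k)`. -/
def absTr {F : Type*} [Field F] (k : ℕ) (x : F) : F :=
  ∑ i ∈ Finset.range k, x ^ 2 ^ i

/-- The relative field trace `Tr^k_j` from `GF(2^k)` to `GF(2^j)`. -/
def relTr {F : Type*} [Field F] (k j : ℕ) (x : F) : F :=
  ∑ i ∈ Finset.range (k / j), x ^ 2 ^ (j * i)

/-- `(-1)^b` for `b ∈ F_2`, viewed inside an ambient field of characteristic two. -/
def sgn {F : Type*} [Field F] (b : F) : ℤ := if b = 0 then 1 else -1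

/-- The subfield `GF(2^k)` of the ambient field, as a finset. -/
def gf (F : Type*) [Field F] [Fintype F] (k : ℕ) : Finset F :=
  Finset.univ.filter fun x => x ^ 2 ^ k = x

/-- The trace of `F_4` down to `F_2`, `tr_2(y) = y + y²`. -/
def tr2 {F : Type*} [Field F] (y : F) : F := y + y ^ 2

/-- The cubic multiplicative character `χ_k(x) = x^((2^k-1)/3)` of `GF(2^k)`. -/
def chi {F : Type*} [Field F] (k : ℕ) (x : F) : F := x ^ ((2 ^ k - 1) / 3)

/-- The Walsh transform at `ω` of a Boolean function on `GF(2^n)`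
(with values in `F_2` inside the ambient field). -/
def walsh {F : Type*} [Field F] [Fintype F] (n : ℕ) (f : F → F) (ω : F) : ℤ :=
  ∑ x : F, sgn (f x + absTr n (ω * x))

/-- The binary Kloosterman sum `K_k(a)` (with the convention `0⁻¹ = 0`). -/
def kloo {F : Type*} [Field F] [Fintype F] (k : ℕ) (a : F) : ℤ :=
  ∑ x ∈ gf F k, sgn (absTr k (a * x + x⁻¹))

/-- The binary cubic sum `C_k(a,b)`. -/
def cub {F : Type*} [Field F] [Fintype F] (k : ℕ) (a b : F) : ℤ :=
  ∑ x ∈ gf F k, sgn (absTr k (a * x ^ 3 + b * x))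

/-- `f_a(x) = Tr^n(a · x^(2^{m₁}-1))`. -/
def fA {F : Type*} [Field F] (n m1 : ℕ) (a x : F) : F :=
  absTr n (a * x ^ (2 ^ m1 - 1))

/-- `g_b(x) = tr_2(b · χ_n(x))`. -/
def gB {F : Type*} [Field F] (n : ℕ) (b x : F) : F := tr2 (b * chi n x)

/-- The binomial Boolean function `f_{a,b} = f_a + g_b`. -/
def fAB {F : Type*} [Field F] (n m1 : ℕ) (a b x : F) : F :=
  fA n m1 a x + gB n b x

/-- `U`, the image of `U_1 × ⋯ × U_ν` in `GF(2^n)^*` under multiplication, where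
`U_i` is the subgroup of `(2^{m_i}+1)`-th roots of unity and `m_i = 2^{ν-i}·m`. -/
def bigU (F : Type*) [Field F] [Fintype F] (ν m : ℕ) : Finset F :=
  Finset.univ.filter fun u => ∃ c : Fin ν → F,
    (∀ i : Fin ν, c i ^ (2 ^ (2 ^ (ν - 1 - (i : ℕ)) * m) + 1) = 1) ∧ u = ∏ i, c i

/-- In a finite cyclic group of order `d * e`, every `e`-torsion element has exactly `d`
`d`-th roots. -/
theorem card_pow_eq_of_pow_eq_one {G : Type*} [CommGroup G] [IsCyclic G] [Fintype G] {d e : ℕ}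
    (hG : Fintype.card G = d * e) {u : G} (hu : u ^ e = 1) :
    #{x : G | x ^ d = u} = d := by
  have hpos : 0 < d * e := hG ▸ Fintype.card_pos
  have he : 0 < e := Nat.pos_of_mul_pos_left hpos
  have hmem : u ∈ Set.range (powMonoidHom d : G →* G) := by
    obtain ⟨g, hg⟩ := IsCyclic.exists_monoid_generator (α := G)
    obtain ⟨k, rfl⟩ := Submonoid.mem_powers_iff _ _ |>.1 (hg u)
    have hord : orderOf g = d * e := by
      rw [← hG, ← Nat.card_eq_fintype_card]
      refine orderOf_eq_card_of_forall_mem_powers hg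
    rw [← pow_mul] at hu
    have hdvd := orderOf_dvd_of_pow_eq_one hu
    rw [hord] at hdvd
    obtain ⟨j, rfl⟩ := Nat.dvd_of_mul_dvd_mul_right he hdvd
    exact ⟨g ^ j, by simp [← pow_mul, mul_comm]⟩
  have hfib := MonoidHom.card_fiber_eq_of_mem_range (powMonoidHom d : G →* G) hmem
    ⟨1, map_one _⟩
  have hker := IsCyclic.card_powMonoidHom_ker (G := G) d
  rw [Nat.card_eq_fintype_card (α := G), hG, Nat.gcd_eq_right (dvd_mul_right d e)] at hker
  simp only [powMonoidHom_apply] at hfib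
  rw [hfib]
  refine Eq.trans ?_ hker
  rw [← SetLike.coe_sort_coe, Nat.card_coe_set_eq, ← Set.ncard_coe_finset]
  congr 1
  ext x
  simp [MonoidHom.mem_ker]

theorem card_ne_zero_and_pow_eq {F : Type*} [Field F] [Fintype F] {d e : ℕ}
    (hF : Fintype.card F - 1 = d * e) {δ : F} (hδ0 : δ ≠ 0) (hδ : δ ^ e = 1) :
    #{x : F | x ≠ 0 ∧ x ^ d = δ} = d := by
  have hG : Fintype.card Fˣ = d * e := by rw [Fintype.card_units, hF]
  have hu : (Units.mk0 δ hδ0) ^ e = 1 := by ext; simpa using hδ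
  refine Eq.trans ?_ (card_pow_eq_of_pow_eq_one hG hu)
  symm
  refine Finset.card_bij (fun x _ => (x : F)) ?_ (fun _ _ _ _ h => Units.ext h) ?_
  · intro x hx
    simpa [Units.ext_iff] using hx
  · intro x hx
    simp only [mem_filter, mem_univ, true_and] at hx
    exact ⟨Units.mk0 x hx.1, by simp [Units.ext_iff, hx.2], rfl⟩

theorem mem_gf {F : Type*} [Field F] [Fintype F] {k : ℕ} {x : F} :
    x ∈ gf F k ↔ x ^ 2 ^ k = x := by simp [gf]

theorem card_gf_erase_zero {F : Type*} [Field F] [Fintype F] {k : ℕ}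
    (hF : Fintype.card F = 2 ^ (2 * k)) : #((gf F k).erase 0) = 2 ^ k - 1 := by
  have hcard : Fintype.card F - 1 = (2 ^ k - 1) * (2 ^ k + 1) := by
    rw [hF, mul_comm 2 k, pow_mul, ← one_pow 2, Nat.sq_sub_sq, one_pow, mul_comm]
  rw [← card_ne_zero_and_pow_eq hcard one_ne_zero (one_pow _)]
  congr 1
  ext x
  simp only [mem_erase, mem_gf, mem_filter, mem_univ, true_and]
  refine and_congr_right fun hx => ?_
  conv_lhs => rw [← Nat.sub_add_cancel (Nat.one_le_two_pow (n := k)), pow_succ]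
  exact mul_eq_right₀ hx

theorem pow_two_pow_sub_one_of_mem_gf_erase_zero {F : Type*} [Field F] [Fintype F] {k : ℕ}
    {r : F} (hr : r ∈ (gf F k).erase 0) : r ^ (2 ^ k - 1) = 1 := by
  have h := mem_gf.1 (mem_of_mem_erase hr)
  rw [← Nat.sub_add_cancel (Nat.one_le_two_pow (n := k)), pow_succ] at h
  exact (mul_eq_right₀ (ne_of_mem_erase hr)).1 h

section CharTwo

variable {F : Type*} [Field F] [CharP F 2]

theorem absTr_add (k : ℕ) (x y : F) : absTr k (x + y) = absTr k x + absTr k y := by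
  simp only [absTr, ← Finset.sum_add_distrib]
  exact Finset.sum_congr rfl fun i _ => add_pow_char_pow x y 2 i

theorem absTr_add_pow (k : ℕ) (x : F) :
    absTr k (x + x ^ 2 ^ k) = absTr (2 * k) x := by
  rw [absTr_add, two_mul]
  simp only [absTr]
  rw [Finset.sum_range_add]
  simp only [← pow_mul, ← pow_add]

theorem absTr_eq_zero_or_one {k : ℕ} {x : F} (hx : x ^ 2 ^ k = x) :
    absTr k x = 0 ∨ absTr k x = 1 := by
  have h : absTr k x ^ 2 = absTr k x := by
    have h1 : absTr k x ^ 2 + x = absTr k x + x := by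
      rw [show absTr k x ^ 2 = ∑ i ∈ Finset.range k, x ^ 2 ^ (i + 1) by
        simp only [absTr]
        rw [sum_pow_char 2]
        exact Finset.sum_congr rfl fun i _ => by rw [← pow_mul, pow_succ]]
      have h2 := Finset.sum_range_succ' (fun i => x ^ 2 ^ i) k
      rw [Finset.sum_range_succ] at h2
      simpa [hx, absTr] using h2.symm
    exact add_right_cancel h1
  have h3 : absTr k x * (absTr k x - 1) = 0 := by linear_combination h
  rcases mul_eq_zero.1 h3 with h | h
  · exact Or.inl h
  · exact Or.inr (sub_eq_zero.1 h)

theorem sgn_add_of_eq_one {b c : F} (hb : b = 0 ∨ b = 1) (hc : c = 1) :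
    sgn (b + c) = -sgn b := by
  subst hc
  rcases hb with rfl | rfl
  · simp [sgn]
  · simp [sgn, CharTwo.add_self_eq_zero]

theorem absTr_one {k : ℕ} (hk : Odd k) : absTr k (1 : F) = 1 := by
  obtain ⟨j, rfl⟩ := hk
  simp [absTr, CharTwo.two_eq_zero]

variable [Fintype F]

theorem sum_gf_sgn_absTr {k : ℕ} (hk : Odd k) (hF : Fintype.card F = 2 ^ (2 * k)) {y : F}
    (hy : y ∉ gf F k) : ∑ r ∈ gf F k, sgn (absTr (2 * k) (r * y)) = 0 := by
  have hall (x : F) : x ^ 2 ^ (2 * k) = x := hF ▸ FiniteField.pow_card x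
  set c := y + y ^ 2 ^ k with hc
  have hc0 : c ≠ 0 := fun h => hy (mem_gf.2 (CharTwo.add_eq_zero.1 h).symm)
  have hck : c ^ 2 ^ k = c := by
    rw [hc, add_pow_char_pow, ← pow_mul, ← pow_add, ← two_mul, hall, add_comm]
  have hck' : c⁻¹ ^ 2 ^ k = c⁻¹ := by rw [inv_pow, hck]
  have htr : absTr (2 * k) (c⁻¹ * y) = 1 := by
    rw [← absTr_add_pow, mul_pow, hck', ← mul_add, ← hc, inv_mul_cancel₀ hc0, absTr_one hk]
  have hneg : ∑ r ∈ gf F k, sgn (absTr (2 * k) (r * y)) =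
      ∑ r ∈ gf F k, -sgn (absTr (2 * k) (r * y)) := by
    refine Finset.sum_nbij' (· + c⁻¹) (· + c⁻¹) ?_ ?_ ?_ ?_ ?_
    · intro r hr
      rw [mem_gf] at hr ⊢
      rw [add_pow_char_pow, hr, hck']
    · intro r hr
      rw [mem_gf] at hr ⊢
      rw [add_pow_char_pow, hr, hck']
    · intro r _
      simp [add_assoc, CharTwo.add_self_eq_zero]
    · intro r _
      simp [add_assoc, CharTwo.add_self_eq_zero]
    · intro r _
      rw [add_mul, absTr_add, sgn_add_of_eq_one (absTr_eq_zero_or_one (hall _)) htr, neg_neg]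
  rw [Finset.sum_neg_distrib] at hneg
  linarith

theorem sum_gf_erase_zero_sgn_absTr {k : ℕ} (hk : Odd k) (hF : Fintype.card F = 2 ^ (2 * k))
    (y : F) : ∑ r ∈ (gf F k).erase 0, sgn (absTr (2 * k) (r * y)) =
      (if y ∈ gf F k then 2 ^ k else 0) - 1 := by
  split_ifs with hy
  · have h1 : ∀ r ∈ (gf F k).erase 0, sgn (absTr (2 * k) (r * y)) = 1 := by
      intro r hr
      have hr := mem_gf.1 (mem_of_mem_erase hr)
      rw [← absTr_add_pow, mul_pow, hr, mem_gf.1 hy, CharTwo.add_self_eq_zero]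
      simp [absTr, sgn]
    rw [Finset.sum_congr rfl h1]
    simp [card_gf_erase_zero hF]
  · have h0 : (0 : F) ∈ gf F k := mem_gf.2 (by simp)
    have h := Finset.add_sum_erase _ (fun r => sgn (absTr (2 * k) (r * y))) h0
    rw [sum_gf_sgn_absTr hk hF hy] at h
    have hz : sgn (absTr (2 * k) (0 * y)) = 1 := by simp [absTr, sgn]
    rw [hz] at h
    linarith

/-- The trace character sum over a fibre of the cubic character. -/
theorem three_mul_sum_sgn_absTr_chi_eq {k : ℕ} (hk : Odd k)
    (hF : Fintype.card F = 2 ^ (2 * k)) {δ : F} (hδ0 : δ ≠ 0) (hδ : δ ^ 3 = 1) :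
    3 * ∑ y : F with y ≠ 0 ∧ chi (2 * k) y = δ, sgn (absTr (2 * k) y) =
      (if δ = 1 then 3 * 2 ^ k else 0) - (2 ^ k + 1) := by
  obtain ⟨t, ht⟩ : 3 ∣ 2 ^ k + 1 := by
    simpa using hk.nat_add_dvd_pow_add_pow 2 1
  have hq : 2 ≤ 2 ^ k := Nat.le_self_pow hk.pos.ne' 2
  have hsq : 2 ^ (2 * k) - 1 = (2 ^ k - 1) * t * 3 := by
    rw [mul_assoc, mul_comm t, ← ht, mul_comm 2 k, pow_mul, ← one_pow 2, Nat.sq_sub_sq,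
      one_pow, mul_comm]
  have hchi (x : F) : chi (2 * k) x = x ^ ((2 ^ k - 1) * t) := by
    rw [chi, hsq, Nat.mul_div_cancel _ (by norm_num)]
  have hchir {r : F} (hr : r ∈ (gf F k).erase 0) : chi (2 * k) r = 1 := by
    rw [hchi, pow_mul, pow_two_pow_sub_one_of_mem_gf_erase_zero hr, one_pow]
  have hchimul (x y : F) : chi (2 * k) (x * y) = chi (2 * k) x * chi (2 * k) y := mul_pow _ _ _
  set A : Finset F := {y : F | y ≠ 0 ∧ chi (2 * k) y = δ} with hA
  have hAcard : #A = (2 ^ k - 1) * t := by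
    simp only [hA, hchi]
    exact card_ne_zero_and_pow_eq (hF ▸ hsq) hδ0 hδ
  have hinv {r : F} (hr : r ∈ (gf F k).erase 0) :
      ∑ y ∈ A, sgn (absTr (2 * k) (r * y)) = ∑ y ∈ A, sgn (absTr (2 * k) y) := by
    have hr0 : r ≠ 0 := ne_of_mem_erase hr
    refine Finset.sum_nbij' (r * ·) (r⁻¹ * ·) ?_ ?_ ?_ ?_ fun _ _ => rfl
    · intro y hy
      simp only [hA, mem_filter, mem_univ, true_and] at hy ⊢
      exact ⟨mul_ne_zero hr0 hy.1, by rw [hchimul, hchir hr, one_mul, hy.2]⟩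
    · intro y hy
      simp only [hA, mem_filter, mem_univ, true_and] at hy ⊢
      refine ⟨mul_ne_zero (inv_ne_zero hr0) hy.1, ?_⟩
      rw [← hy.2, ← one_mul (chi _ (_ * _)), ← hchir hr, ← hchimul, mul_inv_cancel_left₀ hr0]
    · intro y _
      exact inv_mul_cancel_left₀ hr0 y
    · intro y _
      exact mul_inv_cancel_left₀ hr0 y
  have hfilter : A.filter (· ∈ gf F k) = if δ = 1 then (gf F k).erase 0 else ∅ := by
    split_ifs with h
    · ext y
      simp only [hA, mem_filter, mem_univ, true_and, mem_erase]
      exact ⟨fun hy => ⟨hy.1.1, hy.2⟩, fun hy => ⟨⟨hy.1, h ▸ hchir (mem_erase.2 hy)⟩, hy.2⟩⟩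
    · refine Finset.filter_eq_empty_iff.2 fun y hy hyk => h ?_
      simp only [hA, mem_filter, mem_univ, true_and] at hy
      exact hy.2 ▸ hchir (mem_erase.2 ⟨hy.1, hyk⟩)
  have hdouble : ((2 : ℤ) ^ k - 1) * ∑ y ∈ A, sgn (absTr (2 * k) y) =
      (if δ = 1 then ((2 : ℤ) ^ k - 1) * 2 ^ k else 0) - (2 ^ k - 1) * t := by
    calc ((2 : ℤ) ^ k - 1) * ∑ y ∈ A, sgn (absTr (2 * k) y)
        = ∑ r ∈ (gf F k).erase 0, ∑ y ∈ A, sgn (absTr (2 * k) (r * y)) := by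
          rw [Finset.sum_congr rfl fun r hr => hinv hr]
          simp [card_gf_erase_zero hF]
      _ = ∑ y ∈ A, ((if y ∈ gf F k then (2 : ℤ) ^ k else 0) - 1) := by
          rw [Finset.sum_comm]
          exact Finset.sum_congr rfl fun y _ => sum_gf_erase_zero_sgn_absTr hk hF y
      _ = _ := by
          rw [Finset.sum_sub_distrib, ← Finset.sum_filter, hfilter]
          split_ifs <;> simp [card_gf_erase_zero hF, hAcard]
  have hq' : (2 : ℤ) ^ k - 1 ≠ 0 := by
    have : (2 : ℤ) ≤ 2 ^ k := by exact_mod_cast hq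
    omega
  have htz : (2 : ℤ) ^ k + 1 = 3 * t := by exact_mod_cast ht
  apply mul_left_cancel₀ hq'
  rw [mul_left_comm, hdouble, htz]
  split_ifs <;> ring

end CharTwo

/-- For `m₁ = 2·m₂` with `m₂` odd, `a ∈ F_{2^{m₁}}^*`, `γ ∈ F_4^*` and `α = χ_{m₁}(a)`:
`3 · ∑_{x ∈ F_{2^{m₁}}^*, χ_{m₁}(x) = γ} (−1)^{Tr^{m₁}(a·x)} = 2^{m₂+1} − 1` if `γ = α⁻¹`,
and `= −2^{m₂} − 1` if `γ ≠ α⁻¹`. (The ambient field is `F_{2^{m₁}}` itself.) -/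
theorem twisted_cubic_sum
    {F : Type*} [Field F] [Fintype F]
    (m1 m2 : ℕ) (hm2 : Odd m2) (hm1 : m1 = 2 * m2)
    (hF : Fintype.card F = 2 ^ m1)
    (a γ : F) (ha : a ≠ 0) (hγ : γ ^ 3 = 1) (hγ0 : γ ≠ 0) :
    (γ = (chi m1 a)⁻¹ →
      3 * ∑ x ∈ Finset.univ.filter (fun x : F => x ≠ 0 ∧ chi m1 x = γ),
            sgn (absTr m1 (a * x))
        = 2 ^ (m2 + 1) - 1) ∧
    (γ ≠ (chi m1 a)⁻¹ →
      3 * ∑ x ∈ Finset.univ.filter (fun x : F => x ≠ 0 ∧ chi m1 x = γ),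
            sgn (absTr m1 (a * x))
        = -2 ^ m2 - 1) := by
  subst hm1
  have : CharP F 2 := charP_of_card_eq_prime_pow hF
  set α := chi (2 * m2) a with hα
  have hα0 : α ≠ 0 := pow_ne_zero _ ha
  have h3 : 3 ∣ 2 ^ (2 * m2) - 1 := by
    have h := Nat.sub_dvd_pow_sub_pow (2 ^ 2) 1 m2
    rwa [one_pow, ← pow_mul] at h
  have hα3 : α ^ 3 = 1 := by
    rw [hα, chi, ← pow_mul, Nat.div_mul_cancel h3, ← hF]
    exact FiniteField.pow_card_sub_one_eq_one a ha
  have hsum : ∑ x : F with x ≠ 0 ∧ chi (2 * m2) x = γ, sgn (absTr (2 * m2) (a * x)) =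
      ∑ y : F with y ≠ 0 ∧ chi (2 * m2) y = α * γ, sgn (absTr (2 * m2) y) := by
    have hmul (x : F) : chi (2 * m2) (a * x) = α * chi (2 * m2) x := mul_pow _ _ _
    refine Finset.sum_equiv (Equiv.mulLeft₀ a ha) (fun x => ?_) fun _ _ => rfl
    simp [hmul, ha, hα0]
  have key := three_mul_sum_sgn_absTr_chi_eq hm2 hF (mul_ne_zero hα0 hγ0)
    (by rw [mul_pow, hα3, hγ, one_mul])
  have hiff : α * γ = 1 ↔ γ = α⁻¹ := by
    rw [mul_comm, mul_eq_one_iff_eq_inv₀ hα0]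
  rw [hsum, key]
  refine ⟨fun h => ?_, fun h => ?_⟩
  · rw [if_pos (hiff.2 h)]
    ring
  · rw [if_neg (mt hiff.1 h)]
    ring
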